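/- Fix an integer p ≥ 1, reals a > 0 and b > 0, and a point y_i ∈ ℝ^p. For any y_j ∈ ℝ^p with y_j ≠ y_i, the repulsive cost viewed as a function of the second argument, y ↦ c^r(y_i, y) = −ln(1 − (1 + a‖y_i − y‖₂^{2b})^{−1}), is differentiable at y_j, and its gradient there equals (−2b / (‖y_i − y_j‖₂² (1 + a‖y_i − y_j‖₂^{2b}))) · (y_j − y_i). -/

import Mathlib

open Real

/-- The repulsive cost as a function of the squared distance. -/
theorem hasDerivAt_neg_log_one_sub_inv_one_add_mul_rpow {a b s : ℝ} (ha : 0 < a) (hs : 0 < s) :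
    HasDerivAt (fun t : ℝ => -Real.log (1 - (1 + a * t ^ b)⁻¹))
      (-b / (s * (1 + a * s ^ b))) s := by
  have hpow : 0 < s ^ b := Real.rpow_pos_of_pos hs b
  have hden : 1 + a * s ^ b ≠ 0 := by positivity
  have hsub : 1 - (1 + a * s ^ b)⁻¹ = a * s ^ b / (1 + a * s ^ b) := by
    field_simp
    ring
  have hlog : 1 - (1 + a * s ^ b)⁻¹ ≠ 0 := by
    rw [hsub]
    positivity
  have hderiv := (((((Real.hasDerivAt_rpow_const (p := b) (Or.inl hs.ne')).const_mul a).const_add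
    1).fun_inv hden).const_sub 1).log hlog |>.neg
  refine hderiv.congr_deriv ?_
  rw [hsub, Real.rpow_sub_one hs.ne']
  field_simp

/-- The chain rule for a function of the squared distance to a fixed point. -/
theorem HasDerivAt.hasGradientAt_comp_norm_sub_sq {E : Type*} [NormedAddCommGroup E]
    [InnerProductSpace ℝ E] [CompleteSpace E] {g : ℝ → ℝ} {g' : ℝ} {x y : E}
    (hg : HasDerivAt g g' (‖x - y‖ ^ 2)) :
    HasGradientAt (fun z => g (‖x - z‖ ^ 2)) ((2 * g') • (y - x)) y := by
  rw [hasGradientAt_iff_hasFDerivAt]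
  refine (hg.comp_hasFDerivAt y ((hasFDerivAt_id y).const_sub x).norm_sq).congr_fderiv ?_
  ext v
  simp
  ring

/-- For `p ≥ 1`, `a > 0`, `b > 0`, `y_i ∈ ℝ^p` and `y_j ≠ y_i`,
the repulsive cost as a function of the second argument,
`y ↦ −ln(1 − (1 + a‖y_i − y‖₂^{2b})⁻¹)`, is differentiable at `y_j` with gradient
`(−2b / (‖y_i − y_j‖₂² (1 + a‖y_i − y_j‖₂^{2b}))) • (y_j − y_i)`. -/
theorem umap_repulsive_gradient_second_arg
    (p : ℕ) (hp : 1 ≤ p) (a b : ℝ) (ha : 0 < a) (hb : 0 < b)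
    (yi yj : EuclideanSpace ℝ (Fin p)) (hne : yj ≠ yi) :
    HasGradientAt (fun y : EuclideanSpace ℝ (Fin p) =>
        -Real.log (1 - (1 + a * ‖yi - y‖ ^ (2 * b))⁻¹))
      ((-2 * b / (‖yi - yj‖ ^ 2 * (1 + a * ‖yi - yj‖ ^ (2 * b))))
        • (yj - yi)) yj := by
  have hpos : 0 < ‖yi - yj‖ ^ 2 := by
    have := norm_pos_iff.2 (sub_ne_zero.2 hne.symm)
    positivity
  have hpow (y : EuclideanSpace ℝ (Fin p)) : ‖yi - y‖ ^ (2 * b) = (‖yi - y‖ ^ 2) ^ b := by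
    rw [Real.rpow_mul (norm_nonneg _), Real.rpow_two]
  simp only [hpow]
  convert (hasDerivAt_neg_log_one_sub_inv_one_add_mul_rpow (b := b) ha
    hpos).hasGradientAt_comp_norm_sub_sq using 2
  ring
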